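/- Let A be a finite abelian probability group with |A| = m+1. Then for every j with 0 ≤ j ≤ m, the primitive idempotent F_j of ℂ[A] is given by F_j = (1/n_j)·Σ_{a∈A} h_a·μ_j(a*)·a. -/

import Mathlib

open Finset

/-- A probability group: a finite set `A` with `p : A × A × A → ℝ`
(written `p a b c` for `p(a.b = c)`), an identity element `one` and an
involution `star` satisfying the axioms of Harrison. -/
structure ProbabilityGroup (A : Type*) [Fintype A] where
  /-- the structure function `p(a.b = c)` -/
  p : A → A → A → ℝ
  /-- the identity element `1` -/
  one : A
  /-- the involution `a ↦ a*` -/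
  star : A → A
  nonneg : ∀ a b c, 0 ≤ p a b c
  sum_eq_one : ∀ a b, ∑ c, p a b c = 1
  assoc : ∀ a b c d, ∑ x, p a b x * p x c d = ∑ y, p a y d * p b c y
  one_mul : ∀ a, p one a a = 1
  mul_one : ∀ a, p a one a = 1
  star_pos : ∀ b, 0 < p b (star b) one
  star_unique : ∀ b b', 0 < p b b' one → b' = star b
  p_star : ∀ a b c, p a b c = p (star b) (star a) (star c)
  star_symm : ∀ a, p a (star a) one = p (star a) a one

variable {A : Type*} [Fintype A] [DecidableEq A]

/-- The multiplication of `ℂ[A]` (realized as `A → ℂ` via coordinates in the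
basis `A`): on basis elements, `a·b = ∑ c, p(a.b = c) • c`. -/
noncomputable def Pmul (G : ProbabilityGroup A) (f g : A → ℂ) : A → ℂ :=
  fun c => ∑ a : A, ∑ b : A, f a * g b * (G.p a b c : ℂ)

/-- The basis element of `ℂ[A]` corresponding to `a ∈ A`. -/
def delta (a : A) : A → ℂ := fun c => if c = a then 1 else 0

/-- The weight `h_a := 1 / p(a.a* = 1)`. -/
noncomputable def wt (G : ProbabilityGroup A) (a : A) : ℝ :=
  1 / G.p a (G.star a) G.one

/-- The total weight `n(A) := ∑ a, h_a`. -/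
noncomputable def nPG (G : ProbabilityGroup A) : ℝ := ∑ a : A, wt G a

/-- The normalized idempotent `u_A := (1/n(A)) ∑ a, h_a • a`. -/
noncomputable def uA (G : ProbabilityGroup A) : A → ℂ :=
  fun a => ((wt G a / nPG G : ℝ) : ℂ)

/-- Functionals `μ i` on a space of dimension `|ι|` that admit a dual family `F` separate points. -/
theorem eq_of_forall_dual_eq {K V ι : Type*} [Field K] [AddCommGroup V] [Module K V]
    [Fintype ι] [Nonempty ι] [DecidableEq ι] (hdim : Fintype.card ι = Module.finrank K V)
    (μ : ι → V →ₗ[K] K) (F : ι → V) (hF : ∀ i j, μ i (F j) = if i = j then 1 else 0)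
    {x y : V} (h : ∀ i, μ i x = μ i y) : x = y := by
  have hli : LinearIndependent K F := by
    rw [Fintype.linearIndependent_iff]
    intro g hg i
    simpa [hF] using congrArg (μ i) hg
  let B := basisOfLinearIndependentOfCardEqFinrank hli hdim
  have coeff : ∀ z i, μ i z = B.repr z i := by
    intro z i
    conv_lhs => rw [← B.sum_repr z]
    simp [B, hF]
  exact B.ext_elem fun i => by rw [← coeff, ← coeff, h]

namespace ProbabilityGroup

theorem star_star {A : Type*} [Fintype A] (G : ProbabilityGroup A) (a : A) :
    G.star (G.star a) = a :=
  (G.star_unique _ _ (by rw [← G.star_symm]; exact G.star_pos a)).symm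

theorem p_star_right_one_of_ne {A : Type*} [Fintype A] (G : ProbabilityGroup A) {a b : A}
    (h : b ≠ a) : G.p b (G.star a) G.one = 0 := by
  by_contra hne
  have hs := G.star_unique _ _ (lt_of_le_of_ne (G.nonneg _ _ _) (Ne.symm hne))
  exact h (by rw [← G.star_star b, ← hs, G.star_star])

/-- The coefficient of the identity in `f · a*` is `f a * p(a.a* = 1)`. -/
theorem Pmul_delta_star_one {A : Type*} [Fintype A] [DecidableEq A] (G : ProbabilityGroup A)
    (f : A → ℂ) (a : A) :
    Pmul G f (delta (G.star a)) G.one = f a * (G.p a (G.star a) G.one : ℂ) := by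
  have : ∀ b, (∑ c, f b * delta (G.star a) c * (G.p b c G.one : ℂ)) =
      f b * (G.p b (G.star a) G.one : ℂ) := by
    intro b
    simp [delta]
  simp only [Pmul, this]
  refine Finset.sum_eq_single a (fun b _ hb => ?_) (by simp)
  simp [G.p_star_right_one_of_ne hb]

end ProbabilityGroup

/-- For a finite abelian probability group `A` with `|A| = m+1`,
each primitive idempotent satisfies `F_j = (1/n_j) ∑_{a∈A} h_a·μ_j(a*)·a`
(stated coefficientwise in the basis `A`). -/
theorem stmt_6 {A : Type*} [Fintype A] [DecidableEq A] (m : ℕ)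
    (G : ProbabilityGroup A)
    -- `A` is abelian
    (hab : ∀ a b c : A, G.p a b c = G.p b a c)
    -- `|A| = m + 1`
    (hcard : Fintype.card A = m + 1)
    -- `μ_0, …, μ_m` are the distinct `ℂ`-algebra homomorphisms `ℂ[A] → ℂ`:
    (μ : Fin (m + 1) → (A → ℂ) → ℂ)
    (hμlin : ∀ j, IsLinearMap ℂ (μ j))
    (hμmul : ∀ j, ∀ x y : A → ℂ, μ j (Pmul G x y) = μ j x * μ j y)
    (hμunit : ∀ j, μ j (delta G.one) = 1)
    (hμinj : Function.Injective μ)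
    (hμall : ∀ ν : (A → ℂ) → ℂ, IsLinearMap ℂ ν →
      (∀ x y : A → ℂ, ν (Pmul G x y) = ν x * ν y) → ν (delta G.one) = 1 →
      ∃ j, ν = μ j)
    -- `F_0, …, F_m` are the primitive idempotents, `μ_i(F_j) = δ_{ij}`, `∑ F_j = 1`:
    (F : Fin (m + 1) → (A → ℂ))
    (hF : ∀ i j, μ i (F j) = if i = j then 1 else 0)
    (hFsum : ∑ j, F j = delta G.one)
    -- the nonzero scalars `n_j` with `τ(F_j) = 1/n_j`:
    (n : Fin (m + 1) → ℂ)
    (hn : ∀ j, n j ≠ 0)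
    (hτF : ∀ j, F j G.one = 1 / n j)
    :
    ∀ j, ∀ a : A,
      F j a = (1 / n j) * ((wt G a : ℂ) * μ j (delta (G.star a))) := by
  intro j a
  have hp : (G.p a (G.star a) G.one : ℂ) ≠ 0 := by
    exact_mod_cast (G.star_pos a).ne'
  have key : Pmul G (F j) (delta (G.star a)) = μ j (delta (G.star a)) • F j := by
    refine eq_of_forall_dual_eq (K := ℂ) (by simp [hcard])
      (fun i => (hμlin i).mk' (μ i)) F hF fun i => ?_
    simp only [IsLinearMap.mk'_apply, hμmul, (hμlin i).map_smul, hF, smul_eq_mul]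
    split_ifs with hij
    · rw [hij]; ring
    · ring
  have hτ := congrFun key G.one
  rw [G.Pmul_delta_star_one, Pi.smul_apply, hτF, smul_eq_mul] at hτ
  rw [eq_div_of_mul_eq hp hτ, wt]
  push_cast
  ring
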